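/- arXiv:1303.4117 — 2 statements merged into one kernel-verified Lean document; each statement's English description precedes it below -/
import Mathlib

section
/- For all integers k and j with 0 ≤ k ≤ (q − 1)/2 and 0 ≤ j ≤ q + 1, f((3/2)(q − 1) + kq + j) ≤ 3q + j(q + 2 − j). -/
open scoped BigOperators

/-- Points (and, by self-duality of homogeneous coordinates, lines) of the
Desarguesian projective plane `PG(2,q)` over the field `F`. -/
abbrev PG (F : Type*) [Field F] := Projectivization F (Fin 3 → F)

/-- Incidence between a point and a line (the line being given by its dual
homogeneous coordinates): the dot product of representatives vanishes.
This does not depend on the choice of representatives. -/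
def Incid {F : Type*} [Field F] (p l : PG F) : Prop :=
  ∑ i, p.rep i * l.rep i = 0

/-- `𝒫ᵒ(R)`: points incident with an odd number of lines of `R`. -/
def Podd (F : Type*) [Field F] (R : Set (PG F)) : Set (PG F) :=
  {p | Odd {l ∈ R | Incid p l}.ncard}

/-- `𝒫ᵉ(R)`: points incident with an even number of lines of `R`. -/
def Peven (F : Type*) [Field F] (R : Set (PG F)) : Set (PG F) :=
  {p | Even {l ∈ R | Incid p l}.ncard}

/-- `ℒᵒ(S)`: lines meeting `S` in an odd number of points. -/
def Lodd (F : Type*) [Field F] (S : Set (PG F)) : Set (PG F) :=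
  {l | Odd {p ∈ S | Incid p l}.ncard}

/-- `ℒᵉ(S)`: lines meeting `S` in an even number of points. -/
def Leven (F : Type*) [Field F] (S : Set (PG F)) : Set (PG F) :=
  {l | Even {p ∈ S | Incid p l}.ncard}

/-- `f(r)`: the minimum size of the symmetric difference of `r` distinct lines,
i.e. the minimum of `|𝒫ᵒ(R)|` over sets `R` of exactly `r` lines. -/
noncomputable def fmin (F : Type*) [Field F] (r : ℕ) : ℕ :=
  sInf {n | ∃ R : Set (PG F), R.ncard = r ∧ (Podd F R).ncard = n}

open Projectivization in
lemma incid_mk_mk {F : Type*} [Field F] (v w : Fin 3 → F) (hv : v ≠ 0) (hw : w ≠ 0) :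
    Incid (Projectivization.mk F v hv) (Projectivization.mk F w hw) ↔
      v 0 * w 0 + v 1 * w 1 + v 2 * w 2 = 0 := by
  obtain ⟨a, ha⟩ := exists_smul_eq_mk_rep F v hv
  obtain ⟨b, hb⟩ := exists_smul_eq_mk_rep F w hw
  unfold Incid
  rw [← ha, ← hb]
  simp only [Fin.sum_univ_three, Units.smul_def, Pi.smul_apply, smul_eq_mul]
  have : (a : F) * v 0 * (b * w 0) + a * v 1 * (b * w 1) + a * v 2 * (b * w 2)
      = (a * b) * (v 0 * w 0 + v 1 * w 1 + v 2 * w 2) := by ring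
  rw [this]
  simp

/-- coordinates of lines other than `[1:0:0]` -/
def lvec {F : Type*} [Field F] : (F × F) ⊕ F → (Fin 3 → F)
  | Sum.inl ab => ![ab.1, ab.2, 1]
  | Sum.inr a => ![a, 1, 0]

lemma lvec_ne {F : Type*} [Field F] (d : (F × F) ⊕ F) : lvec d ≠ 0 := by
  rcases d with ⟨a, b⟩ | a
  · intro h
    have := congrFun h 2
    simp [lvec] at this
  · intro h
    have := congrFun h 1
    simp [lvec] at this

/-- the line with given parameters -/
def gline {F : Type*} [Field F] (d : (F × F) ⊕ F) : PG F :=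
  Projectivization.mk F (lvec d) (lvec_ne d)

lemma gline_inj {F : Type*} [Field F] : Function.Injective (gline (F := F)) := by
  intro d e h
  unfold gline at h
  rw [Projectivization.mk_eq_mk_iff'] at h
  obtain ⟨c, hc⟩ := h
  have h0 := congrFun hc 0
  have h1 := congrFun hc 1
  have h2 := congrFun hc 2
  rcases d with ⟨a, b⟩ | a <;> rcases e with ⟨a', b'⟩ | a' <;> simp [lvec] at h0 h1 h2
  · subst h2; simp at h0 h1; simp [h0, h1]
  · subst h2; simp at h1
  · subst h1; simp at h0; simp [h0]

lemma rep_cases {F : Type*} [Field F] (p : PG F) :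
    ∃ (v : Fin 3 → F) (hv : v ≠ 0), p = Projectivization.mk F v hv :=
  ⟨p.rep, p.rep_nonzero, p.mk_rep.symm⟩

lemma mk_eq_of {F : Type*} [Field F] (v w : Fin 3 → F) (hv : v ≠ 0) (hw : w ≠ 0) (c : F)
    (h0 : c * w 0 = v 0) (h1 : c * w 1 = v 1) (h2 : c * w 2 = v 2) :
    Projectivization.mk F v hv = Projectivization.mk F w hw := by
  rw [Projectivization.mk_eq_mk_iff']
  refine ⟨c, ?_⟩
  funext i
  fin_cases i <;> simpa

open Classical in
/-- Double counting bound for dual arcs. -/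
lemma arc_bound {P ι : Type*} [Fintype P] [DecidableEq ι] (I : P → ι → Prop) (J : Finset ι) (q : ℕ)
    (hj : J.card ≤ q + 1)
    (h1 : ∀ i ∈ J, (Finset.univ.filter (fun p => I p i)).card ≤ q + 1)
    (h2 : ∀ i ∈ J, ∀ i' ∈ J, i ≠ i' → ∃ p, I p i ∧ I p i')
    (h3 : ∀ p, (J.filter (I p)).card ≤ 2) :
    (Finset.univ.filter (fun p => Odd (J.filter (I p)).card)).card
      ≤ J.card * (q + 2 - J.card) := by
  have e1 : ∑ p, (J.filter (I p)).card ≤ J.card * (q + 1) := by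
    have : ∑ p, (J.filter (I p)).card = ∑ i ∈ J, (Finset.univ.filter (fun p => I p i)).card := by
      simp only [Finset.card_filter]
      exact Finset.sum_comm
    rw [this]
    calc _ ≤ ∑ i ∈ J, (q + 1) := Finset.sum_le_sum h1
      _ = _ := by simp
  have e2 : J.offDiag.card ≤ ∑ p, (J.filter (I p)).offDiag.card := by
    have : ∀ p, (J.filter (I p)).offDiag = J.offDiag.filter (fun x => I p x.1 ∧ I p x.2) := by
      intro p; ext ⟨a, b⟩; simp; tauto
    simp only [this, Finset.card_filter]
    rw [Finset.sum_comm, Finset.card_eq_sum_ones]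
    refine Finset.sum_le_sum ?_
    rintro ⟨a, b⟩ hab
    simp only [Finset.mem_offDiag] at hab
    obtain ⟨p, hp⟩ := h2 a hab.1 b hab.2.1 hab.2.2
    rw [← Finset.card_filter]
    exact Finset.card_pos.2 ⟨p, by simpa using hp⟩
  have e3 : (Finset.univ.filter (fun p => Odd (J.filter (I p)).card)).card
      + ∑ p, (J.filter (I p)).offDiag.card = ∑ p, (J.filter (I p)).card := by
    rw [Finset.card_filter, ← Finset.sum_add_distrib]
    refine Finset.sum_congr rfl fun p _ => ?_
    have := h3 p
    rw [Finset.offDiag_card]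
    generalize (J.filter (I p)).card = d at this
    interval_cases d <;> decide
  rw [Finset.offDiag_card] at e2
  obtain ⟨m, hm⟩ : ∃ m, q + 1 = J.card + m := ⟨q + 1 - J.card, by omega⟩
  have : q + 2 - J.card = m + 1 := by omega
  rw [this]
  rw [hm] at e1
  have e4 : J.card ≤ J.card * J.card := Nat.le_mul_self _
  have e5 := Nat.sub_le_iff_le_add.1 e2
  nlinarith

/-- lines of the dual conic -/
def cline {F : Type*} [Field F] (n : F) : Option F → (F × F) ⊕ F
  | none => Sum.inr 0
  | some s => Sum.inl (s, -(n * s ^ 2))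

lemma cline_inj {F : Type*} [Field F] (n : F) : Function.Injective (cline n) := by
  intro a b h
  rcases a with _ | a <;> rcases b with _ | b <;> simp [cline] at h
  · rfl
  · rw [h.1]

lemma conic_meet {F : Type*} [Field F] (n : F) (i i' : Option F) (h : i ≠ i') :
    ∃ p : PG F, Incid p (gline (cline n i)) ∧ Incid p (gline (cline n i')) := by
  have key : ∀ s : F, ∃ p : PG F, Incid p (gline (cline n none)) ∧
      Incid p (gline (cline n (some s))) := by
    intro s
    refine ⟨Projectivization.mk F ![1, 0, -s] (fun h => by simpa using congrFun h 0), ?_, ?_⟩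
    · simp [gline, incid_mk_mk, cline, lvec]
    · simp [gline, incid_mk_mk, cline, lvec]
  rcases i with _ | s <;> rcases i' with _ | t
  · exact absurd rfl h
  · exact key t
  · obtain ⟨p, h1, h2⟩ := key s
    exact ⟨p, h2, h1⟩
  · refine ⟨Projectivization.mk F ![n * (s + t), 1, -(n * s * t)]
      (fun h => by simpa using congrFun h 1), ?_, ?_⟩
    · simp [gline, incid_mk_mk, cline, lvec]; ring
    · simp [gline, incid_mk_mk, cline, lvec]; ring

open Classical in
lemma conic_two {F : Type*} [Field F] (n : F) (hn : n ≠ 0) (J : Finset (Option F)) (p : PG F) :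
    (J.filter (fun i => Incid p (gline (cline n i)))).card ≤ 2 := by
  by_contra! hc
  obtain ⟨v, hv, rfl⟩ := rep_cases p
  rw [Finset.two_lt_card] at hc
  obtain ⟨a, ha, b, hb, c, hc, hab, hac, hbc⟩ := hc
  simp only [Finset.mem_filter] at ha hb hc
  replace ha := ha.2
  replace hb := hb.2
  replace hc := hc.2
  have hz : ¬ (v 0 = 0 ∧ v 1 = 0 ∧ v 2 = 0) := by
    rintro ⟨h0, h1, h2⟩
    apply hv; funext i; fin_cases i <;> simpa
  have key : ∀ s t : F, s ≠ t → v 1 = 0 → v 0 * s + v 1 * -(n * s ^ 2) + v 2 = 0 →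
      v 0 * t + v 1 * -(n * t ^ 2) + v 2 = 0 → False := by
    intro s t hst h1 h2 h3
    have h0 : v 0 * (s - t) = 0 := by rw [h1] at h2 h3; linear_combination h2 - h3
    have h0' : v 0 = 0 := by
      rcases mul_eq_zero.1 h0 with h | h
      · exact h
      · exact absurd (sub_eq_zero.1 h) hst
    refine hz ⟨h0', h1, ?_⟩
    rw [h0', h1] at h2; simpa using h2
  rcases a with _ | a <;> rcases b with _ | b <;> rcases c with _ | c <;>
    simp only [ne_eq, not_true_eq_false, Option.some.injEq] at hab hac hbc <;>
    simp only [gline, incid_mk_mk, cline, lvec, Matrix.cons_val_zero, Matrix.cons_val_one,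
      Matrix.cons_val, mul_zero, mul_one, add_zero, zero_add] at ha hb hc
  · exact key b c hbc ha hb hc
  · exact key a c hac hb ha hc
  · exact key a b hab hc ha hb
  · have e1 : v 0 - v 1 * n * (a + b) = 0 := by
      have : (a - b) * (v 0 - v 1 * n * (a + b)) = 0 := by linear_combination ha - hb
      rcases mul_eq_zero.1 this with h | h
      · exact absurd (sub_eq_zero.1 h) hab
      · exact h
    have e2 : v 0 - v 1 * n * (a + c) = 0 := by
      have : (a - c) * (v 0 - v 1 * n * (a + c)) = 0 := by linear_combination ha - hc
      rcases mul_eq_zero.1 this with h | h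
      · exact absurd (sub_eq_zero.1 h) hac
      · exact h
    have e3 : v 1 = 0 := by
      have : (b - c) * n * v 1 = 0 := by linear_combination e2 - e1
      rcases mul_eq_zero.1 this with h | h
      · rcases mul_eq_zero.1 h with h | h
        · exact absurd (sub_eq_zero.1 h) hbc
        · exact absurd h hn
      · exact h
    exact key a b hab e3 ha hb

open Classical in
lemma conic_line_card {F : Type*} [Field F] [Fintype F] [Fintype (PG F)] (n : F) (i : Option F) :
    (Finset.univ.filter (fun p : PG F => Incid p (gline (cline n i)))).card
      ≤ Fintype.card F + 1 := by
  have : ∃ φ : Option F → PG F, ∀ p : PG F, Incid p (gline (cline n i)) → ∃ t, φ t = p := by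
    rcases i with _ | s
    · refine ⟨fun o => match o with
        | none => Projectivization.mk F ![0, 0, 1] (fun h => by simpa using congrFun h 2)
        | some t => Projectivization.mk F ![1, 0, t] (fun h => by simpa using congrFun h 0), ?_⟩
      intro p hp
      obtain ⟨v, hv, rfl⟩ := rep_cases p
      simp [gline, incid_mk_mk, cline, lvec] at hp
      by_cases h : v 0 = 0
      · refine ⟨none, (mk_eq_of _ _ _ _ (v 2) ?_ ?_ ?_).symm⟩ <;> simp [h, hp]
      · refine ⟨some (v 2 / v 0), (mk_eq_of _ _ _ _ (v 0) ?_ ?_ ?_).symm⟩ <;> simp [hp]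
        field_simp
    · refine ⟨fun o => match o with
        | none => Projectivization.mk F ![0, 1, n * s ^ 2] (fun h => by simpa using congrFun h 1)
        | some t => Projectivization.mk F ![1, t, t * (n * s ^ 2) - s]
            (fun h => by simpa using congrFun h 0), ?_⟩
      intro p hp
      obtain ⟨v, hv, rfl⟩ := rep_cases p
      simp [gline, incid_mk_mk, cline, lvec] at hp
      by_cases h : v 0 = 0
      · refine ⟨none, (mk_eq_of _ _ _ _ (v 1) ?_ ?_ ?_).symm⟩ <;> simp [h]
        rw [h] at hp
        linear_combination -hp
      · refine ⟨some (v 1 / v 0), (mk_eq_of _ _ _ _ (v 0) ?_ ?_ ?_).symm⟩ <;> simp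
        · field_simp
        · field_simp
          linear_combination -hp
  obtain ⟨φ, hφ⟩ := this
  calc _ ≤ (Finset.univ.image φ).card := by
        apply Finset.card_le_card
        intro p hp
        simp only [Finset.mem_filter, Finset.mem_univ, true_and] at hp
        obtain ⟨t, ht⟩ := hφ p hp
        exact Finset.mem_image.2 ⟨t, Finset.mem_univ _, ht⟩
    _ ≤ (Finset.univ : Finset (Option F)).card := Finset.card_image_le
    _ = _ := by simp

/-- the triangle of reference -/
def Tri (F : Type*) [Field F] : Set (PG F) :=
  {p | p.rep 0 = 0 ∨ p.rep 1 = 0 ∨ p.rep 2 = 0}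

lemma tri_card {F : Type*} [Field F] [Fintype F] : (Tri F).ncard ≤ 3 * Fintype.card F := by
  classical
  let φ : Fin 3 × F → PG F := fun x => match x with
    | (0, t) => Projectivization.mk F ![0, 1, t] (fun h => by simpa using congrFun h 1)
    | (1, t) => Projectivization.mk F ![t, 0, 1] (fun h => by simpa using congrFun h 2)
    | (2, t) => Projectivization.mk F ![1, t, 0] (fun h => by simpa using congrFun h 0)
  have hsub : Tri F ⊆ φ '' Set.univ := by
    intro p hp
    rw [← p.mk_rep]
    rcases hp with h | h | h
    · by_cases h' : p.rep 1 = 0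
      · refine ⟨(1, 0), trivial, (mk_eq_of _ _ _ _ (p.rep 2) ?_ ?_ ?_).symm⟩ <;> simp [h, h']
      · refine ⟨(0, p.rep 2 / p.rep 1), trivial,
          (mk_eq_of _ _ _ _ (p.rep 1) ?_ ?_ ?_).symm⟩ <;> simp [h]
        field_simp
    · by_cases h' : p.rep 2 = 0
      · refine ⟨(2, 0), trivial, (mk_eq_of _ _ _ _ (p.rep 0) ?_ ?_ ?_).symm⟩ <;> simp [h, h']
      · refine ⟨(1, p.rep 0 / p.rep 2), trivial,
          (mk_eq_of _ _ _ _ (p.rep 2) ?_ ?_ ?_).symm⟩ <;> simp [h]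
        field_simp
    · by_cases h' : p.rep 0 = 0
      · refine ⟨(0, 0), trivial, (mk_eq_of _ _ _ _ (p.rep 1) ?_ ?_ ?_).symm⟩ <;> simp [h, h']
      · refine ⟨(2, p.rep 1 / p.rep 0), trivial,
          (mk_eq_of _ _ _ _ (p.rep 0) ?_ ?_ ?_).symm⟩ <;> simp [h]
        field_simp
  calc _ ≤ (φ '' Set.univ).ncard := Set.ncard_le_ncard hsub (Set.toFinite _)
    _ ≤ (Set.univ : Set (Fin 3 × F)).ncard := Set.ncard_image_le (Set.toFinite _)
    _ = _ := by rw [Set.ncard_univ]; simp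

open Classical in
lemma count_sq {F : Type*} [Field F] [Fintype F] (hq : Odd (Fintype.card F)) :
    (Finset.univ.filter (fun a : F => quadraticChar F a = 1)).card = (Fintype.card F - 1) / 2 ∧
    (Finset.univ.filter (fun a : F => quadraticChar F a = -1)).card
      = (Fintype.card F - 1) / 2 := by
  have hF : ringChar F ≠ 2 := by
    intro h
    have := (FiniteField.even_card_iff_char_two (F := F)).1 h
    rw [Nat.odd_iff] at hq
    omega
  have h0 := quadraticChar_sum_zero hF
  have h1 : ∀ a : F, quadraticChar F a = (if quadraticChar F a = 1 then (1 : ℤ) else 0)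
      - (if quadraticChar F a = -1 then (1 : ℤ) else 0) := by
    intro a
    rcases quadraticChar_isQuadratic F a with h | h | h <;> rw [h] <;> decide
  have h2 : ∀ a : F, (1 : ℤ) = (if quadraticChar F a = 1 then (1 : ℤ) else 0)
      + (if quadraticChar F a = -1 then (1 : ℤ) else 0) + (if a = 0 then 1 else 0) := by
    intro a
    by_cases ha : a = 0
    · simp [ha]
    · rcases quadraticChar_dichotomy ha with h | h <;> rw [h] <;> simp [ha]
  rw [Finset.sum_congr rfl (fun a _ => h1 a), Finset.sum_sub_distrib] at h0
  have h3 : ∑ a : F, (1 : ℤ) = Fintype.card F := by simp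
  rw [Finset.sum_congr rfl (fun a _ => h2 a), Finset.sum_add_distrib,
    Finset.sum_add_distrib] at h3
  have h4 : ∑ a : F, (if a = 0 then (1 : ℤ) else 0) = 1 := by simp
  rw [h4] at h3
  simp only [Finset.sum_boole] at h0 h3
  constructor <;> omega

/-- base configuration: index type -/
abbrev BaseIx (F : Type*) := (F ⊕ F ⊕ F) ⊕ (F × F)

/-- base configuration lines -/
def bline {F : Type*} [Field F] : BaseIx F → (F × F) ⊕ F
  | Sum.inl (Sum.inl u) => Sum.inl (0, -u)
  | Sum.inl (Sum.inr (Sum.inl v)) => Sum.inl (-v, 0)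
  | Sum.inl (Sum.inr (Sum.inr w)) => Sum.inr (-w)
  | Sum.inr (a, t) => Sum.inl (a, -t)

/-- base set of indices -/
def bset {F : Type*} [Field F] (N V T : Finset F) [Fintype F] : Finset (BaseIx F) :=
  (N.disjSum (V.disjSum N)).disjSum (Finset.univ ×ˢ T)

open Classical in
lemma base_count {F : Type*} [Field F] [Fintype F] (N V T : Finset F) (v : Fin 3 → F) (hv : v ≠ 0)
    (h0 : v 0 ≠ 0) (h1 : v 1 ≠ 0) (h2 : v 2 ≠ 0) :
    ((bset N V T).filter (fun i => Incid (Projectivization.mk F v hv) (gline (bline i)))).card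
    = (if v 2 / v 1 ∈ N then 1 else 0) + (if v 2 / v 0 ∈ V then 1 else 0)
      + (if v 1 / v 0 ∈ N then 1 else 0) + T.card := by
  have hN : ∀ (N : Finset F) (x : F) (P : F → Prop), (∀ u, P u ↔ x = u) →
      (N.filter P).card = if x ∈ N then 1 else 0 := by
    intro N x P hP
    rw [Finset.filter_congr (fun u _ => hP u), Finset.filter_eq]
    split_ifs <;> simp
  have e : ((bset N V T).filter
      (fun i => Incid (Projectivization.mk F v hv) (gline (bline i)))).card =
    (N.filter (fun u => v 1 * -u + v 2 = 0)).card + ((V.filter (fun u => v 0 * -u + v 2 = 0)).card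
     + (N.filter (fun u => v 0 * -u + v 1 = 0)).card)
     + ((Finset.univ ×ˢ T).filter (fun x : F × F => v 0 * x.1 + v 1 * -x.2 + v 2 = 0)).card := by
    simp only [bset, Finset.card_filter, Finset.sum_disjSum]
    simp [gline, incid_mk_mk, bline, lvec]
  rw [e, hN N (v 2 / v 1), hN V (v 2 / v 0), hN N (v 1 / v 0)]
  · have : ((Finset.univ ×ˢ T).filter
        (fun x : F × F => v 0 * x.1 + v 1 * -x.2 + v 2 = 0)).card = T.card := by
      symm
      apply Finset.card_bij (fun t _ => ((v 1 * t - v 2) / v 0, t))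
      · intro t ht
        simp [ht]
        field_simp
        ring
      · intro a _ b _ h
        exact (Prod.ext_iff.1 h).2
      · rintro ⟨a, t⟩ h
        simp at h
        refine ⟨t, h.1, ?_⟩
        simp
        field_simp
        linear_combination -h.2
    rw [this]; ring
  · intro u; rw [div_eq_iff h0]; constructor <;> intro h <;> linear_combination h
  · intro u; rw [div_eq_iff h0]; constructor <;> intro h <;> linear_combination h
  · intro u; rw [div_eq_iff h1]; constructor <;> intro h <;> linear_combination h

/-- `f((3/2)(q − 1) + kq + j) ≤ 3q + j(q + 2 − j)` for `0 ≤ k ≤ (q − 1)/2`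
and `0 ≤ j ≤ q + 1`. -/
theorem stmt14 {F : Type*} [Field F] [Fintype F] (q : ℕ)
    (hcard : Fintype.card F = q) (hq : Odd q)
    (k j : ℕ) (hk : k ≤ (q - 1) / 2) (hj : j ≤ q + 1) :
    fmin F (3 * (q - 1) / 2 + k * q + j) ≤ 3 * q + j * (q + 2 - j) := by
  classical
  subst hcard
  have : Fintype (PG F) := Fintype.ofFinite _
  obtain ⟨hS, hN⟩ := count_sq hq
  set q := Fintype.card F with hqdef
  set S := Finset.univ.filter (fun a : F => quadraticChar F a = 1) with hSdef
  set N := Finset.univ.filter (fun a : F => quadraticChar F a = -1) with hNdef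
  have hq2 : 2 ≤ q := Fintype.one_lt_card
  obtain ⟨h, hh⟩ := hq
  have hh1 : (q - 1) / 2 = h := by omega
  rw [hh1] at hS hN hk
  have hNne : N.Nonempty := by rw [← Finset.card_pos, hN]; omega
  obtain ⟨n, hn⟩ := hNne
  obtain ⟨T, hTS, hT⟩ := Finset.exists_subset_card_eq (hk.trans hS.ge)
  obtain ⟨J, -, hJ⟩ := Finset.exists_subset_card_eq
    (s := (Finset.univ : Finset (Option F))) (n := j) (by simpa using hj)
  obtain ⟨V, hVc, hV0, hVpar⟩ : ∃ V : Finset F, V.card = h ∧ (0 : F) ∉ V ∧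
      ∀ x : F, x ≠ 0 → (if x ∈ V then 1 else 0) + k ≡ (if x ∈ N then 1 else 0) [MOD 2] := by
    rcases Nat.even_or_odd k with hk2 | hk2
    · refine ⟨N, hN, by simp [hNdef], fun x _ => ?_⟩
      rw [Nat.even_iff] at hk2
      simp only [Nat.ModEq]; omega
    · refine ⟨S, hS, by simp [hSdef], fun x hx => ?_⟩
      rw [Nat.odd_iff] at hk2
      simp only [hSdef, hNdef, Finset.mem_filter, Finset.mem_univ, true_and]
      rcases quadraticChar_dichotomy hx with h' | h' <;> rw [h'] <;> simp [Nat.ModEq] <;> omega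
  have hn1 : quadraticChar F n = -1 := by simpa [hNdef] using hn
  have hn0 : n ≠ 0 := by rintro rfl; simp at hn1
  have hN0 : (0 : F) ∉ N := by simp [hNdef]
  have hT1 : ∀ t ∈ T, quadraticChar F t = 1 := fun t ht => by simpa [hSdef] using hTS ht
  have hNm : ∀ t, t ∈ N ↔ quadraticChar F t = -1 := fun t => by simp [hNdef]
  -- the combined index set
  let L : BaseIx F ⊕ Option F → PG F := fun x => gline (Sum.elim bline (cline n) x)
  let D : Finset (BaseIx F ⊕ Option F) := (bset N V T).disjSum J
  have hT0 : (0 : F) ∉ T := fun h0 => by simpa using hT1 0 h0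
  have hNT : ∀ t ∈ T, t ∉ N := fun t ht h' => by
    rw [hNm, hT1 t ht] at h'; norm_num at h'
  have hsT : ∀ s : F, n * s ^ 2 ∉ T := fun s hs => by
    have h1 := hT1 _ hs
    have hs0 : s ≠ 0 := by rintro rfl; simp at h1
    rw [map_mul, hn1, quadraticChar_sq_one' hs0] at h1
    norm_num at h1
  have hLinj : Set.InjOn L D := by
    have : Set.InjOn (Sum.elim bline (cline n)) (D : Set (BaseIx F ⊕ Option F)) := by
      have hNe : ∀ u ∈ N, u ≠ 0 := fun u hu h => hN0 (h ▸ hu)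
      have hVe : ∀ u ∈ V, u ≠ 0 := fun u hu h => hV0 (h ▸ hu)
      have hTe : ∀ u ∈ T, u ≠ 0 := fun u hu h => hT0 (h ▸ hu)
      rintro (((a | a | a) | ⟨a, a'⟩) | (_ | a)) ha (((b | b | b) | ⟨b, b'⟩) | (_ | b)) hb hab <;>
        simp [D, bset] at ha hb <;> simp [bline, cline] at hab ⊢ <;> grind
    exact fun a ha b hb hab => this ha hb (gline_inj hab)
  have hDcard : D.card = 3 * (q - 1) / 2 + k * q + j := by
    have e1 : D.card = (h + (h + h)) + q * k + j := by
      simp only [D, bset, Finset.card_disjSum, Finset.card_product, hN, hVc, hT, hJ,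
        Finset.card_univ, ← hqdef]
    have : 3 * (q - 1) / 2 = 3 * h := by omega
    rw [e1, this]; ring
  have hcount : ∀ p : PG F, {l ∈ L '' (D : Set (BaseIx F ⊕ Option F)) | Incid p l}.ncard
      = ((bset N V T).filter (fun i => Incid p (gline (bline i)))).card
        + (J.filter (fun i => Incid p (gline (cline n i)))).card := by
    intro p
    have e1 : {l ∈ L '' (D : Set (BaseIx F ⊕ Option F)) | Incid p l}
        = L '' ((D.filter (fun i => Incid p (L i)) : Finset _) : Set (BaseIx F ⊕ Option F)) := by
      ext l
      simp only [Set.mem_image, Finset.coe_filter, Set.mem_setOf_eq, Finset.mem_coe]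
      constructor
      · rintro ⟨⟨x, hx, rfl⟩, hl⟩; exact ⟨x, ⟨hx, hl⟩, rfl⟩
      · rintro ⟨x, ⟨hx, hl⟩, rfl⟩; exact ⟨⟨x, hx, rfl⟩, hl⟩
    rw [e1, Set.ncard_image_of_injOn (hLinj.mono
      (Finset.coe_subset.2 (Finset.filter_subset _ _))), Set.ncard_coe_finset]
    simp only [D, L, Finset.card_filter, Finset.sum_disjSum, Sum.elim_inl, Sum.elim_inr]
    congr!
  have heven : ∀ p : PG F, p ∉ Tri F →
      Even ((bset N V T).filter (fun i => Incid p (gline (bline i)))).card := by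
    intro p hp
    simp only [Tri, Set.mem_setOf_eq, not_or] at hp
    obtain ⟨h0, h1, h2⟩ := hp
    have e := base_count N V T p.rep p.rep_nonzero h0 h1 h2
    rw [p.mk_rep, hT] at e
    rw [e]
    have hpar := hVpar (p.rep 2 / p.rep 0) (div_ne_zero h2 h0)
    have hm : quadraticChar F (p.rep 2 / p.rep 0)
        = quadraticChar F (p.rep 2 / p.rep 1) * quadraticChar F (p.rep 1 / p.rep 0) := by
      rw [← map_mul]; congr 1; field_simp
    rw [Nat.even_iff]
    simp only [hNm, Nat.ModEq] at hpar ⊢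
    rw [hm] at hpar
    rcases quadraticChar_dichotomy (div_ne_zero h2 h1) with h' | h' <;>
    rcases quadraticChar_dichotomy (div_ne_zero h1 h0) with h'' | h'' <;>
    rw [h', h''] at hpar <;> rw [h', h''] <;> norm_num at hpar ⊢ <;> omega
  have hJb := arc_bound (fun (p : PG F) i => Incid p (gline (cline n i))) J q (by omega)
    (fun i _ => conic_line_card n i) (fun i _ i' _ hne => conic_meet n i i' hne)
    (fun p => conic_two n hn0 J p)
  rw [hJ] at hJb
  have hfin : (Podd F (L '' (D : Set (BaseIx F ⊕ Option F)))).ncard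
      ≤ 3 * q + j * (q + 2 - j) := by
    have hsub : Podd F (L '' (D : Set (BaseIx F ⊕ Option F))) ⊆ Tri F ∪
        ((Finset.univ.filter (fun p : PG F =>
          Odd (J.filter (fun i => Incid p (gline (cline n i)))).card) : Finset (PG F)) :
            Set (PG F)) := by
      intro p hp
      by_cases hpT : p ∈ Tri F
      · exact Or.inl hpT
      · right
        have hp' : Odd {l ∈ L '' (D : Set (BaseIx F ⊕ Option F)) | Incid p l}.ncard := hp
        rw [hcount p, Nat.odd_add] at hp'
        simp only [Finset.coe_filter, Finset.mem_univ, true_and, Set.mem_setOf_eq]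
        rw [← Nat.not_even_iff_odd]
        intro hE
        exact Nat.not_even_iff_odd.2 (hp'.2 hE) (heven p hpT)
    refine (Set.ncard_le_ncard hsub (Set.toFinite _)).trans ((Set.ncard_union_le _ _).trans ?_)
    rw [Set.ncard_coe_finset]
    exact add_le_add tri_card hJb
  refine le_trans (Nat.sInf_le ⟨L '' (D : Set (BaseIx F ⊕ Option F)), ?_, rfl⟩) hfin
  rw [Set.ncard_image_of_injOn hLinj, Set.ncard_coe_finset, hDcard]
end

section
/- For all integers k and j with 0 ≤ k ≤ (q − 1)/2, k even, and 0 ≤ j ≤ q − 1, f(q + 1 + kq + j) ≤ q + 1 + k + j(q + 2 − j). -/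
open scoped BigOperators

section Helpers

open Projectivization Configuration

variable {F : Type*} [Field F]

lemma incid_iff (p l : PG F) : Incid p l ↔ p.orthogonal l := by
  conv_rhs => rw [← p.mk_rep, ← l.mk_rep]
  exact (orthogonal_mk p.rep_nonzero l.rep_nonzero).symm

lemma line_card [Fintype F] (l : PG F) :
    {p : PG F | Incid p l}.ncard = Fintype.card F + 1 := by
  classical
  haveI : Fintype (PG F) := Fintype.ofFinite _
  have h1 := ProjectivePlane.card_points (PG F) (PG F)
  have h2 := Projectivization.card_of_finrank F (Fin 3 → F) (n := 3) (by simp)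
  have h3 := ProjectivePlane.pointCount_eq (PG F) l
  have h4 : ProjectivePlane.order (PG F) (PG F) = Fintype.card F := by
    rw [Nat.card_eq_fintype_card, Nat.card_eq_fintype_card] at h2
    rw [h2] at h1
    simp only [Finset.sum_range_succ, Finset.sum_range_zero] at h1
    nlinarith [h1, Nat.lt_trichotomy (ProjectivePlane.order (PG F) (PG F)) (Fintype.card F)]
  rw [← h4, ← h3, Configuration.pointCount, ← Nat.card_coe_set_eq]
  apply Nat.card_congr
  apply Equiv.subtypeEquivRight
  intro p
  exact incid_iff p l

lemma exists_meet (l m : PG F) : ∃ p : PG F, l ≠ m → Incid p l ∧ Incid p m := by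
  classical
  refine ⟨cross l m, fun h => ?_⟩
  rw [incid_iff, incid_iff]
  exact ⟨cross_orthogonal_left h, cross_orthogonal_right h⟩

lemma arc_bound_s16 [Fintype F] (D : Finset (PG F))
    (h : ∀ p : PG F, ∀ a ∈ D, ∀ b ∈ D, ∀ c ∈ D, Incid p a → Incid p b → Incid p c →
      a = b ∨ a = c ∨ b = c) :
    (Podd F (D : Set (PG F))).ncard ≤ D.card * (Fintype.card F + 2 - D.card) := by
  classical
  haveI : Fintype (PG F) := Fintype.ofFinite _
  let G : PG F → Finset (PG F) := fun l =>
    Finset.univ.filter (fun p => Incid p l ∧ ∀ m ∈ D, Incid p m → m = l)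
  have hsub : Podd F (D : Set (PG F)) ⊆ ((D.biUnion G : Finset (PG F)) : Set (PG F)) := by
    intro p hp
    have hp' : Odd {l ∈ (D : Set (PG F)) | Incid p l}.ncard := hp
    have h2 : {l ∈ (D : Set (PG F)) | Incid p l}.ncard ≤ 2 := by
      by_contra hc
      push Not at hc
      rw [Set.two_lt_ncard_iff (Set.toFinite _)] at hc
      obtain ⟨a, b, c, ha, hb, hc, h1, h2, h3⟩ := hc
      rcases h p a ha.1 b hb.1 c hc.1 ha.2 hb.2 hc.2 with h | h | h <;> contradiction
    have h1 : {l ∈ (D : Set (PG F)) | Incid p l}.ncard = 1 := by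
      obtain ⟨r, hr⟩ := hp'
      omega
    rw [Set.ncard_eq_one] at h1
    obtain ⟨l, hl⟩ := h1
    have hl1 : l ∈ {l ∈ (D : Set (PG F)) | Incid p l} := by rw [hl]; rfl
    simp only [Finset.coe_biUnion, Set.mem_iUnion, G]
    refine ⟨l, hl1.1, ?_⟩
    simp only [Finset.coe_filter, Set.mem_setOf_eq, Finset.mem_univ, true_and]
    refine ⟨hl1.2, fun m hm hpm => ?_⟩
    have : m ∈ {l ∈ (D : Set (PG F)) | Incid p l} := ⟨hm, hpm⟩
    rw [hl] at this
    exact this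
  have hG : ∀ l ∈ D, (G l).card ≤ Fintype.card F + 2 - D.card := by
    intro l hl
    choose g hg using fun m => exists_meet l m
    have himg : ((D.erase l).image g).card = D.card - 1 := by
      rw [Finset.card_image_of_injOn, Finset.card_erase_of_mem hl]
      intro a ha b hb hab
      simp only [Finset.coe_erase, Set.mem_diff, Finset.mem_coe, Set.mem_singleton_iff] at ha hb
      have h1 := hg a (Ne.symm ha.2)
      have h2 := hg b (Ne.symm hb.2)
      rw [← hab] at h2
      rcases h (g a) l hl a ha.1 b hb.1 h1.1 h1.2 h2.2 with h | h | h
      · exact absurd h.symm ha.2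
      · exact absurd h.symm hb.2
      · exact h
    have hdisj : Disjoint (G l) ((D.erase l).image g) := by
      rw [Finset.disjoint_left]
      intro p hp hp2
      simp only [G, Finset.mem_filter, Finset.mem_univ, true_and] at hp
      simp only [Finset.mem_image, Finset.mem_erase] at hp2
      obtain ⟨m, ⟨hm1, hm2⟩, rfl⟩ := hp2
      exact hm1 (hp.2 m hm2 (hg m (Ne.symm hm1)).2)
    have hsub2 : G l ∪ (D.erase l).image g ⊆ Finset.univ.filter (fun p => Incid p l) := by
      intro p hp
      simp only [Finset.mem_filter, Finset.mem_univ, true_and]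
      rcases Finset.mem_union.1 hp with hp | hp
      · simp only [G, Finset.mem_filter, Finset.mem_univ, true_and] at hp
        exact hp.1
      · simp only [Finset.mem_image, Finset.mem_erase] at hp
        obtain ⟨m, ⟨hm1, hm2⟩, rfl⟩ := hp
        exact (hg m (Ne.symm hm1)).1
    have h5 := Finset.card_le_card hsub2
    rw [Finset.card_union_of_disjoint hdisj, himg] at h5
    have h6 := line_card l
    have h7 : {p : PG F | Incid p l} =
        ((Finset.univ.filter (fun p => Incid p l) : Finset (PG F)) : Set (PG F)) := by
      ext p; simp
    rw [h7, Set.ncard_coe_finset] at h6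
    have : 0 < D.card := Finset.card_pos.2 ⟨l, hl⟩
    omega
  calc (Podd F (D : Set (PG F))).ncard
      ≤ ((D.biUnion G : Finset (PG F)) : Set (PG F)).ncard :=
        Set.ncard_le_ncard hsub (Set.toFinite _)
    _ = (D.biUnion G).card := Set.ncard_coe_finset _
    _ ≤ _ := Finset.card_biUnion_le_card_mul _ _ _ hG

/-- The affine line with coordinates `(1, y, w)`. -/
def affL (a : F × F) : PG F := Projectivization.mk F ![1, a.1, a.2] (by
  intro h; have := congrFun h 0; simp at this)

/-- The line with coordinates `(0, 1, 0)`. -/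
def infL (F : Type*) [Field F] : PG F := Projectivization.mk F ![0, 1, 0] (by
  intro h; have := congrFun h 1; simp at this)

lemma incid_mk (p : PG F) (v : Fin 3 → F) (hv : v ≠ 0) :
    Incid p (Projectivization.mk F v hv) ↔
      p.rep 0 * v 0 + p.rep 1 * v 1 + p.rep 2 * v 2 = 0 := by
  rw [incid_iff]
  conv_lhs => rw [← p.mk_rep]
  rw [orthogonal_mk p.rep_nonzero hv, dotProduct, Fin.sum_univ_three]

lemma incid_affL (p : PG F) (a : F × F) :
    Incid p (affL a) ↔ p.rep 0 + p.rep 1 * a.1 + p.rep 2 * a.2 = 0 := by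
  rw [affL, incid_mk]; simp

lemma incid_infL (p : PG F) : Incid p (infL F) ↔ p.rep 1 = 0 := by
  rw [infL, incid_mk]; simp

lemma affL_inj : Function.Injective (affL : F × F → PG F) := by
  intro a b h
  rw [affL, affL, mk_eq_mk_iff'] at h
  obtain ⟨c, hc⟩ := h
  have h0 := congrFun hc 0
  have h1 := congrFun hc 1
  have h2 := congrFun hc 2
  simp at h0 h1 h2
  subst h0
  ext
  · simpa using h1.symm
  · simpa using h2.symm

lemma affL_ne_infL (a : F × F) : affL a ≠ infL F := by
  intro h
  rw [affL, infL, mk_eq_mk_iff'] at h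
  obtain ⟨c, hc⟩ := h
  have h0 := congrFun hc 0
  simp at h0

lemma rep_zero_false (p : PG F) (h0 : p.rep 0 = 0) (h1 : p.rep 1 = 0) (h2 : p.rep 2 = 0) :
    False := by
  apply p.rep_nonzero
  ext i
  fin_cases i <;> assumption

lemma conic2 (p : PG F) (d s t : F) (hd : d ≠ 0) (hst : s ≠ t)
    (hs : Incid p (affL (d * s ^ 2, d * s))) (ht : Incid p (affL (d * t ^ 2, d * t))) :
    p.rep 1 * (s + t) + p.rep 2 = 0 := by
  rw [incid_affL] at hs ht
  simp only at hs ht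
  have : d * (s - t) * (p.rep 1 * (s + t) + p.rep 2) = 0 := by linear_combination hs - ht
  have h2 : d * (s - t) ≠ 0 := mul_ne_zero hd (sub_ne_zero.2 hst)
  exact (mul_eq_zero.1 this).resolve_left h2

lemma conic_inf (p : PG F) (d s t : F) (hd : d ≠ 0) (hst : s ≠ t)
    (hs : Incid p (affL (d * s ^ 2, d * s))) (ht : Incid p (affL (d * t ^ 2, d * t)))
    (h1 : p.rep 1 = 0) : False := by
  have h2 := conic2 p d s t hd hst hs ht
  rw [h1, zero_mul, zero_add] at h2
  rw [incid_affL, h1, h2] at hs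
  exact rep_zero_false p (by simpa using hs) h1 h2

lemma conic3 (p : PG F) (d s t u : F) (hd : d ≠ 0)
    (hs : Incid p (affL (d * s ^ 2, d * s))) (ht : Incid p (affL (d * t ^ 2, d * t)))
    (hu : Incid p (affL (d * u ^ 2, d * u))) : s = t ∨ s = u ∨ t = u := by
  by_contra hc
  push Not at hc
  obtain ⟨h1, h2, h3⟩ := hc
  have e1 := conic2 p d s t hd h1 hs ht
  have e2 := conic2 p d s u hd h2 hs hu
  have : p.rep 1 * (t - u) = 0 := by linear_combination e1 - e2
  exact conic_inf p d s t hd h1 hs ht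
    ((mul_eq_zero.1 this).resolve_right (sub_ne_zero.2 h3))

lemma pencil_bound [Fintype F] (hq : Odd (Fintype.card F)) (B : Finset F) (hB : Even B.card) :
    (Podd F (affL '' ((B : Set F) ×ˢ (Set.univ : Set F)))).ncard ≤ B.card := by
  classical
  have hne : ∀ b : F, ![-b, 1, 0] ≠ (0 : Fin 3 → F) := by
    intro b h; have := congrFun h 1; simp at this
  have key : Podd F (affL '' ((B : Set F) ×ˢ (Set.univ : Set F))) ⊆
      ((B.image (fun b => (Projectivization.mk F ![-b, 1, 0] (hne b) : PG F)) :
        Finset (PG F)) : Set (PG F)) := by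
    intro p hp
    have hp' : Odd {l ∈ affL '' ((B : Set F) ×ˢ (Set.univ : Set F)) | Incid p l}.ncard := hp
    have e : {l ∈ affL '' ((B : Set F) ×ˢ (Set.univ : Set F)) | Incid p l} =
        affL '' {a : F × F | a.1 ∈ B ∧ p.rep 0 + p.rep 1 * a.1 + p.rep 2 * a.2 = 0} := by
      ext l
      constructor
      · rintro ⟨⟨a, ha, rfl⟩, hl⟩
        exact ⟨a, ⟨by simpa using ha.1, (incid_affL p a).1 hl⟩, rfl⟩
      · rintro ⟨a, ha, rfl⟩
        exact ⟨⟨a, by simpa using ha.1, rfl⟩, (incid_affL p a).2 ha.2⟩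
    rw [e, Set.ncard_image_of_injective _ affL_inj] at hp'
    by_cases hz : p.rep 2 = 0
    · have hex : ∃ b ∈ B, p.rep 0 + p.rep 1 * b = 0 := by
        by_contra hc
        push Not at hc
        have : {a : F × F | a.1 ∈ B ∧ p.rep 0 + p.rep 1 * a.1 + p.rep 2 * a.2 = 0} = ∅ := by
          ext a
          simp only [Set.mem_setOf_eq, Set.mem_empty_iff_false, iff_false, not_and]
          intro ha
          rw [hz, zero_mul, add_zero]
          exact hc _ ha
        rw [this] at hp'
        simp at hp'
      obtain ⟨b, hb, hb2⟩ := hex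
      simp only [Finset.coe_image, Set.mem_image, Finset.mem_coe]
      refine ⟨b, hb, ?_⟩
      rw [← p.mk_rep, mk_eq_mk_iff']
      have h1 : p.rep 1 ≠ 0 := by
        intro h1
        rw [h1, zero_mul, add_zero] at hb2
        exact rep_zero_false p hb2 h1 hz
      refine ⟨(p.rep 1)⁻¹, ?_⟩
      have h0 : p.rep 0 = - (p.rep 1 * b) := by linear_combination hb2
      ext i
      fin_cases i
      · simp [h0, h1]
      · simp [h1]
      · simp [hz]
    · exfalso
      have : {a : F × F | a.1 ∈ B ∧ p.rep 0 + p.rep 1 * a.1 + p.rep 2 * a.2 = 0} =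
          (fun b => (b, -(p.rep 0 + p.rep 1 * b) / p.rep 2)) '' (B : Set F) := by
        ext ⟨a, c⟩
        simp only [Set.mem_setOf_eq, Set.mem_image, Finset.mem_coe, Prod.mk.injEq]
        constructor
        · rintro ⟨ha, h⟩
          refine ⟨a, ha, rfl, ?_⟩
          rw [div_eq_iff hz]
          linear_combination -h
        · rintro ⟨b, hb, rfl, rfl⟩
          refine ⟨hb, ?_⟩
          field_simp
          ring
      rw [this, Set.ncard_image_of_injective _ (by intro a b h; exact (Prod.mk.inj h).1),
        Set.ncard_coe_finset] at hp'
      exact (Nat.not_odd_iff_even.2 hB) hp'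
  calc _ ≤ _ := Set.ncard_le_ncard key (Set.toFinite _)
    _ = _ := Set.ncard_coe_finset _
    _ ≤ _ := Finset.card_image_le

lemma podd_union (R S : Set (PG F)) [Finite (PG F)] (h : Disjoint R S) :
    (Podd F (R ∪ S)).ncard ≤ (Podd F R).ncard + (Podd F S).ncard := by
  refine le_trans (Set.ncard_le_ncard ?_ (Set.toFinite _)) (Set.ncard_union_le _ _)
  intro p hp
  have hp' : Odd {l ∈ R ∪ S | Incid p l}.ncard := hp
  have e : {l ∈ R ∪ S | Incid p l} = {l ∈ R | Incid p l} ∪ {l ∈ S | Incid p l} := by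
    ext l
    simp only [Set.mem_setOf_eq, Set.mem_union]
    tauto
  rw [e, Set.ncard_union_eq (h.mono (Set.sep_subset _ _) (Set.sep_subset _ _)) (Set.toFinite _)
    (Set.toFinite _), Nat.odd_add] at hp'
  by_cases h1 : Odd {l ∈ R | Incid p l}.ncard
  · exact Or.inl h1
  · right
    change Odd _
    rw [← Nat.not_even_iff_odd]
    tauto

lemma nonsq_card [Fintype F] [DecidableEq F] (hq : Odd (Fintype.card F)) :
    (Fintype.card F - 1) / 2 ≤ (Finset.univ.filter (fun a : F => ¬ IsSquare a)).card := by
  have hF : ringChar F ≠ 2 := by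
    intro h
    have := FiniteField.even_card_of_char_two h
    rw [Nat.odd_iff] at hq
    omega
  have h := quadraticChar_sum_zero hF
  have h1 : (Finset.univ.filter (fun a : F => IsSquare a)).card ≤
      (Finset.univ.filter (fun a : F => ¬ IsSquare a)).card + 1 := by
    have h2 : ∀ a : F, (if IsSquare a then (1 : ℤ) else 0) - (if ¬ IsSquare a then 1 else 0)
        ≤ quadraticChar F a + if a = 0 then 1 else 0 := by
      intro a
      by_cases ha : a = 0
      · subst ha; simp
      · by_cases hs : IsSquare a
        · simp [ha, hs, (quadraticChar_one_iff_isSquare ha).2 hs]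
        · simp [ha, hs, quadraticChar_neg_one_iff_not_isSquare.2 hs]
    have h3 := Finset.sum_le_sum (s := Finset.univ) (fun a _ => h2 a)
    rw [Finset.sum_sub_distrib, Finset.sum_add_distrib, h] at h3
    simp only [Finset.sum_boole, Finset.sum_ite_eq', Finset.mem_univ, if_true] at h3
    have h4 : (Finset.univ.filter (fun a : F => a = 0)).card = 1 := by simp [Finset.filter_eq']
    rw [h4] at h3
    push_cast at h3
    omega
  have h5 := Finset.card_filter_add_card_filter_not (s := (Finset.univ : Finset F)) (fun a : F => IsSquare a)
  rw [Finset.card_univ] at h5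
  omega

end Helpers

/-- `f(q + 1 + kq + j) ≤ q + 1 + k + j(q + 2 − j)` for `0 ≤ k ≤ (q − 1)/2`,
`k` even, and `0 ≤ j ≤ q − 1`. -/
theorem stmt16 {F : Type*} [Field F] [Fintype F] (q : ℕ)
    (hcard : Fintype.card F = q) (hq : Odd q)
    (k j : ℕ) (hk : k ≤ (q - 1) / 2) (hke : Even k) (hj : j ≤ q - 1) :
    fmin F (q + 1 + k * q + j) ≤ q + 1 + k + j * (q + 2 - j) := by
  classical
  subst hcard
  haveI : Fintype (PG F) := Fintype.ofFinite _
  have hq3 : 1 < Fintype.card F := Fintype.one_lt_card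
  obtain ⟨B, hBs, hBc⟩ := Finset.exists_subset_card_eq (hk.trans (nonsq_card (F := F) hq))
  have hBns : ∀ b ∈ B, ¬ IsSquare b := fun b hb => (Finset.mem_filter.1 (hBs hb)).2
  have hne : (-1 : F) ≠ 1 := by
    apply Ring.neg_one_ne_one_of_char_ne_two
    intro h
    have := FiniteField.even_card_of_char_two h
    rw [Nat.odd_iff] at hq
    omega
  have hd : ∃ d : F, d ≠ 0 ∧ d ≠ 1 ∧ (k = 0 ∨ IsSquare d) := by
    rcases Nat.eq_zero_or_pos k with h0 | h0
    · exact ⟨-1, by simp, hne, Or.inl h0⟩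
    · have h4 : ({0, 1, -1} : Finset F).card < (Finset.univ : Finset F).card := by
        refine lt_of_le_of_lt Finset.card_le_three ?_
        rw [Finset.card_univ]
        obtain ⟨r, hr⟩ := hke
        omega
      obtain ⟨u, -, hu⟩ := Finset.exists_mem_notMem_of_card_lt_card h4
      simp only [Finset.mem_insert, Finset.mem_singleton, not_or] at hu
      refine ⟨u ^ 2, pow_ne_zero _ hu.1, ?_, Or.inr ⟨u, sq u⟩⟩
      intro h
      rcases (sq_eq_sq_iff_eq_or_eq_neg.1 (h.trans (one_pow 2).symm)) with h | h
      · exact hu.2.1 h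
      · exact hu.2.2 h
  obtain ⟨d, hd0, hd1, hdk⟩ := hd
  obtain ⟨J, hJs, hJc⟩ := Finset.exists_subset_card_eq
    (s := (Finset.univ : Finset F).erase 0) (n := j) (by
      rw [Finset.card_erase_of_mem (Finset.mem_univ _), Finset.card_univ]; exact hj)
  have hJ0 : ∀ t ∈ J, t ≠ 0 := fun t ht => (Finset.mem_erase.1 (hJs ht)).1
  have ginj : ∀ e : F, e ≠ 0 → Function.Injective (fun t : F => affL (e * t ^ 2, e * t)) := by
    intro e he a b hab
    have := (Prod.mk.inj (affL_inj hab)).2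
    exact mul_left_cancel₀ he this
  let A0 : Finset (PG F) := Finset.univ.image (fun t : F => affL ((1 : F) * t ^ 2, (1 : F) * t))
  have hA0inf : infL F ∉ A0 := by
    intro h
    obtain ⟨t, -, ht⟩ := Finset.mem_image.1 h
    exact affL_ne_infL _ ht
  let A : Finset (PG F) := insert (infL F) A0
  have hAc : A.card = Fintype.card F + 1 := by
    rw [Finset.card_insert_of_notMem hA0inf, Finset.card_image_of_injective _
      (ginj 1 one_ne_zero), Finset.card_univ]
  let C : Finset (PG F) := J.image (fun t : F => affL (d * t ^ 2, d * t))
  have hCc : C.card = j := by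
    rw [Finset.card_image_of_injective _ (ginj d hd0), hJc]
  let P : Set (PG F) := affL '' ((B : Set F) ×ˢ (Set.univ : Set F))
  have hPc : P.ncard = k * Fintype.card F := by
    rw [Set.ncard_image_of_injective _ affL_inj, Set.ncard_prod, Set.ncard_coe_finset, hBc,
      Set.ncard_univ, Nat.card_eq_fintype_card]
  have hA : (Podd F (A : Set (PG F))).ncard ≤ Fintype.card F + 1 := by
    have := arc_bound_s16 A ?_
    · rw [hAc] at this
      have e : Fintype.card F + 2 - (Fintype.card F + 1) = 1 := by omega
      rwa [e, mul_one] at this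
    · intro p a ha b hb c hc hpa hpb hpc
      rcases Finset.mem_insert.1 ha with rfl | ha <;> rcases Finset.mem_insert.1 hb with rfl | hb <;>
        rcases Finset.mem_insert.1 hc with rfl | hc
      · simp
      · simp
      · simp
      · obtain ⟨t, -, rfl⟩ := Finset.mem_image.1 hb
        obtain ⟨u, -, rfl⟩ := Finset.mem_image.1 hc
        by_cases htu : t = u
        · simp [htu]
        · exact (conic_inf p 1 t u one_ne_zero htu hpb hpc ((incid_infL p).1 hpa)).elim
      · simp
      · obtain ⟨t, -, rfl⟩ := Finset.mem_image.1 ha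
        obtain ⟨u, -, rfl⟩ := Finset.mem_image.1 hc
        by_cases htu : t = u
        · simp [htu]
        · exact (conic_inf p 1 t u one_ne_zero htu hpa hpc ((incid_infL p).1 hpb)).elim
      · obtain ⟨t, -, rfl⟩ := Finset.mem_image.1 ha
        obtain ⟨u, -, rfl⟩ := Finset.mem_image.1 hb
        by_cases htu : t = u
        · simp [htu]
        · exact (conic_inf p 1 t u one_ne_zero htu hpa hpb ((incid_infL p).1 hpc)).elim
      · obtain ⟨s, -, rfl⟩ := Finset.mem_image.1 ha
        obtain ⟨t, -, rfl⟩ := Finset.mem_image.1 hb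
        obtain ⟨u, -, rfl⟩ := Finset.mem_image.1 hc
        rcases conic3 p 1 s t u one_ne_zero hpa hpb hpc with h | h | h <;> simp [h]
  have hC : (Podd F (C : Set (PG F))).ncard ≤ j * (Fintype.card F + 2 - j) := by
    have := arc_bound_s16 C ?_
    · rwa [hCc] at this
    · intro p a ha b hb c hc hpa hpb hpc
      obtain ⟨s, -, rfl⟩ := Finset.mem_image.1 ha
      obtain ⟨t, -, rfl⟩ := Finset.mem_image.1 hb
      obtain ⟨u, -, rfl⟩ := Finset.mem_image.1 hc
      rcases conic3 p d s t u hd0 hpa hpb hpc with h | h | h <;> simp [h]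
  have hP : (Podd F P).ncard ≤ k := by
    have := pencil_bound hq B (by rw [hBc]; exact hke)
    rwa [hBc] at this
  have hAP : Disjoint (A : Set (PG F)) P := by
    rw [Set.disjoint_left]
    rintro l hl ⟨⟨b, w⟩, ha, rfl⟩
    rcases Finset.mem_insert.1 (Finset.mem_coe.1 hl) with h | h
    · exact affL_ne_infL _ h
    · obtain ⟨t, -, ht⟩ := Finset.mem_image.1 h
      have h1 := (Prod.mk.inj (affL_inj ht)).1
      have hb : b ∈ B := by simpa using ha
      exact hBns b hb ⟨t, by rw [← h1]; ring⟩
  have hAPC : Disjoint ((A : Set (PG F)) ∪ P) (C : Set (PG F)) := by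
    rw [Set.disjoint_right]
    intro l hl
    obtain ⟨t, ht, rfl⟩ := Finset.mem_image.1 (Finset.mem_coe.1 hl)
    rintro (h | ⟨⟨b, w⟩, ha, hh⟩)
    · rcases Finset.mem_insert.1 (Finset.mem_coe.1 h) with h | h
      · exact affL_ne_infL _ h
      · obtain ⟨s, -, hs⟩ := Finset.mem_image.1 h
        have h1 := (Prod.mk.inj (affL_inj hs)).1
        have h2 := (Prod.mk.inj (affL_inj hs)).2
        rw [one_mul] at h1 h2
        subst h2
        have h3 : d * t ^ 2 * (d - 1) = 0 := by linear_combination h1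
        exact (mul_ne_zero (mul_ne_zero hd0 (pow_ne_zero 2 (hJ0 t ht))) (sub_ne_zero.2 hd1)) h3
    · have h1 := (Prod.mk.inj (affL_inj hh)).1
      have hb : b ∈ B := by simpa using ha
      rcases hdk with hk0 | ⟨u, hu⟩
      · rw [hk0, Finset.card_eq_zero] at hBc
        rw [hBc] at hb
        simp at hb
      · exact hBns b hb ⟨u * t, by rw [h1, hu]; ring⟩
  have hcardR : (((A : Set (PG F)) ∪ P) ∪ (C : Set (PG F))).ncard =
      Fintype.card F + 1 + k * Fintype.card F + j := by
    rw [Set.ncard_union_eq hAPC (Set.toFinite _) (Set.toFinite _),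
      Set.ncard_union_eq hAP (Set.toFinite _) (Set.toFinite _), Set.ncard_coe_finset,
      Set.ncard_coe_finset, hAc, hCc, hPc]
  have h1 := podd_union _ _ hAPC
  have h2 := podd_union _ _ hAP
  refine le_trans (Nat.sInf_le ⟨_, hcardR, rfl⟩) ?_
  omega
end
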